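/- arXiv:1703.09096 — 8 statements merged into one kernel-verified Lean document; each statement's English description precedes it below -/
import Mathlib

section
/- A real n×m matrix Z satisfies P(Z) = Z if and only if there exist a real n×r matrix U_ξ with Uᵀ U_ξ = 0, a real m×r matrix V_ξ with Vᵀ V_ξ = 0, and a real r×r matrix S_ξ such that Z = U_ξ Vᵀ + U V_ξᵀ + U S_ξ Vᵀ; moreover this decomposition is unique (given by U_ξ = (I − U Uᵀ) Z V, V_ξ = (I − V Vᵀ) Zᵀ U, S_ξ = Uᵀ Z V). -/
open Matrix

/-- A matrix `Z` is in the range of the tangent-space projector `P` iff it admits a gauged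
parametrization `Z = U_ξ Vᵀ + U V_ξᵀ + U S_ξ Vᵀ` with `Uᵀ U_ξ = 0` and `Vᵀ V_ξ = 0`;
moreover the decomposition is unique, given by `U_ξ = (I − UUᵀ) Z V`,
`V_ξ = (I − VVᵀ) Zᵀ U`, `S_ξ = Uᵀ Z V`. -/
theorem tangent_space_parametrization
    (n m r : ℕ) (hn : 0 < n) (hm : 0 < m) (hr : 0 < r)
    (U : Matrix (Fin n) (Fin r) ℝ) (V : Matrix (Fin m) (Fin r) ℝ)
    (hU : Uᵀ * U = 1) (hV : Vᵀ * V = 1)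
    (P : Matrix (Fin n) (Fin m) ℝ → Matrix (Fin n) (Fin m) ℝ)
    (hP : ∀ Z, P Z = U * Uᵀ * Z + Z * (V * Vᵀ) - U * Uᵀ * Z * (V * Vᵀ)) :
    (∀ Z : Matrix (Fin n) (Fin m) ℝ,
      P Z = Z ↔
        ∃ (Uξ : Matrix (Fin n) (Fin r) ℝ) (Vξ : Matrix (Fin m) (Fin r) ℝ)
          (Sξ : Matrix (Fin r) (Fin r) ℝ),
          Uᵀ * Uξ = 0 ∧ Vᵀ * Vξ = 0 ∧ Z = Uξ * Vᵀ + U * Vξᵀ + U * Sξ * Vᵀ) ∧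
    (∀ (Z : Matrix (Fin n) (Fin m) ℝ) (Uξ : Matrix (Fin n) (Fin r) ℝ)
       (Vξ : Matrix (Fin m) (Fin r) ℝ) (Sξ : Matrix (Fin r) (Fin r) ℝ),
      Uᵀ * Uξ = 0 → Vᵀ * Vξ = 0 → Z = Uξ * Vᵀ + U * Vξᵀ + U * Sξ * Vᵀ →
        Uξ = (1 - U * Uᵀ) * Z * V ∧ Vξ = (1 - V * Vᵀ) * Zᵀ * U ∧ Sξ = Uᵀ * Z * V) := by
  have hU' : ∀ {k : ℕ} (X : Matrix (Fin r) (Fin k) ℝ), Uᵀ * (U * X) = X := by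
    intro k X
    rw [← Matrix.mul_assoc, hU, Matrix.one_mul]
  have hV' : ∀ {k : ℕ} (X : Matrix (Fin r) (Fin k) ℝ), Vᵀ * (V * X) = X := by
    intro k X
    rw [← Matrix.mul_assoc, hV, Matrix.one_mul]
  refine ⟨fun Z => ⟨fun h => ?_, ?_⟩, ?_⟩
  · refine ⟨(1 - U * Uᵀ) * Z * V, (1 - V * Vᵀ) * Zᵀ * U, Uᵀ * Z * V, ?_, ?_, ?_⟩
    · simp only [Matrix.sub_mul, Matrix.mul_sub, Matrix.mul_assoc, Matrix.one_mul, hU', sub_self]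
    · simp only [Matrix.sub_mul, Matrix.mul_sub, Matrix.mul_assoc, Matrix.one_mul, hV', sub_self]
    · rw [hP] at h
      refine h.symm.trans ?_
      simp only [Matrix.sub_mul, Matrix.mul_sub, Matrix.mul_assoc, Matrix.one_mul, Matrix.mul_one,
        Matrix.transpose_mul, Matrix.transpose_sub, Matrix.transpose_transpose,
        Matrix.transpose_one]
      abel
  · rintro ⟨A, B, S, hA, hB, rfl⟩
    have hA' : ∀ {k : ℕ} (X : Matrix (Fin r) (Fin k) ℝ), Uᵀ * (A * X) = 0 := by
      intro k X
      rw [← Matrix.mul_assoc, hA, Matrix.zero_mul]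
    have hB1 : Bᵀ * V = 0 := by simpa using congrArg Matrix.transpose hB
    have hB' : ∀ {k : ℕ} (X : Matrix (Fin r) (Fin k) ℝ), Bᵀ * (V * X) = 0 := by
      intro k X
      rw [← Matrix.mul_assoc, hB1, Matrix.zero_mul]
    rw [hP]
    simp only [Matrix.add_mul, Matrix.mul_add, Matrix.mul_assoc, hU', hV', hA', hB',
      Matrix.mul_zero, add_zero, zero_add]
    abel
  · rintro Z A B S hA hB rfl
    have hA' : ∀ {k : ℕ} (X : Matrix (Fin r) (Fin k) ℝ), Uᵀ * (A * X) = 0 := by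
      intro k X
      rw [← Matrix.mul_assoc, hA, Matrix.zero_mul]
    have hB1 : Bᵀ * V = 0 := by simpa using congrArg Matrix.transpose hB
    have hA1 : Aᵀ * U = 0 := by simpa using congrArg Matrix.transpose hA
    have hB' : ∀ {k : ℕ} (X : Matrix (Fin r) (Fin k) ℝ), Vᵀ * (B * X) = 0 := by
      intro k X
      rw [← Matrix.mul_assoc, hB, Matrix.zero_mul]
    refine ⟨?_, ?_, ?_⟩ <;>
    simp [Matrix.add_mul, Matrix.mul_add, Matrix.sub_mul, Matrix.mul_assoc, hU', hV', hA', hB',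
      hA1, hB1, hA, hB, hU, hV]
end

section
/- Assume ‖S‖_F = 1. A real n×m matrix Z satisfies both P(Z) = Z and ⟨X, Z⟩ = 0 if and only if there exist a real n×r matrix U_ξ with Uᵀ U_ξ = 0, a real m×r matrix V_ξ with Vᵀ V_ξ = 0, and a real r×r matrix S_ξ with ⟨S_ξ, S⟩ = 0 such that Z = U_ξ Vᵀ + U V_ξᵀ + U S_ξ Vᵀ. (This is the parametrization of the tangent space of the intersection of the unit sphere with the rank-r manifold.) -/
open Matrix

/-- Parametrization of the tangent space of the intersection of the unit sphere with the
rank-`r` manifold: assuming `‖S‖_F = 1`, a matrix `Z` satisfies `P Z = Z` and `⟨X, Z⟩ = 0`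
iff `Z = U_ξ Vᵀ + U V_ξᵀ + U S_ξ Vᵀ` with gauge conditions `Uᵀ U_ξ = 0`, `Vᵀ V_ξ = 0`,
`⟨S_ξ, S⟩ = 0`. -/
theorem sphere_intersection_tangent_parametrization
    (n m r : ℕ) (hn : 0 < n) (hm : 0 < m) (hr : 0 < r)
    (U : Matrix (Fin n) (Fin r) ℝ) (V : Matrix (Fin m) (Fin r) ℝ)
    (S : Matrix (Fin r) (Fin r) ℝ)
    (hU : Uᵀ * U = 1) (hV : Vᵀ * V = 1)
    (hS : (Sᵀ * S).trace = 1)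
    (X : Matrix (Fin n) (Fin m) ℝ) (hX : X = U * S * Vᵀ)
    (P : Matrix (Fin n) (Fin m) ℝ → Matrix (Fin n) (Fin m) ℝ)
    (hP : ∀ Z, P Z = U * Uᵀ * Z + Z * (V * Vᵀ) - U * Uᵀ * Z * (V * Vᵀ)) :
    ∀ Z : Matrix (Fin n) (Fin m) ℝ,
      (P Z = Z ∧ (Xᵀ * Z).trace = 0) ↔
        ∃ (Uξ : Matrix (Fin n) (Fin r) ℝ) (Vξ : Matrix (Fin m) (Fin r) ℝ)
          (Sξ : Matrix (Fin r) (Fin r) ℝ),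
          Uᵀ * Uξ = 0 ∧ Vᵀ * Vξ = 0 ∧ (Sξᵀ * S).trace = 0 ∧
          Z = Uξ * Vᵀ + U * Vξᵀ + U * Sξ * Vᵀ := by
  intro Z
  have key : (Xᵀ * Z).trace = ((Uᵀ * Z * V)ᵀ * S).trace := by
    rw [← trace_transpose ((Uᵀ * Z * V)ᵀ * S), hX]
    simp only [transpose_mul, transpose_transpose, Matrix.mul_assoc]
    rw [trace_mul_comm V]
    simp only [Matrix.mul_assoc]
  rw [key, hP]
  constructor
  · rintro ⟨h1, h2⟩
    refine ⟨Z * V - U * (Uᵀ * Z * V), Zᵀ * U - V * (Vᵀ * Zᵀ * U), Uᵀ * Z * V, ?_, ?_, h2, ?_⟩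
    · rw [Matrix.mul_sub, ← Matrix.mul_assoc Uᵀ U, hU, Matrix.one_mul, Matrix.mul_assoc, sub_self]
    · rw [Matrix.mul_sub, ← Matrix.mul_assoc Vᵀ V, hV, Matrix.one_mul, Matrix.mul_assoc, sub_self]
    · conv_lhs => rw [← h1]
      simp only [transpose_sub, transpose_mul, transpose_transpose, Matrix.mul_sub,
        Matrix.sub_mul, Matrix.mul_assoc]
      abel
  · rintro ⟨A, B, C, hA, hB, hC, hZ⟩
    have hB' : Bᵀ * V = 0 := by
      have := congrArg transpose hB
      simpa using this
    have e1 : Uᵀ * Z = Bᵀ + C * Vᵀ := by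
      rw [hZ]
      simp only [Matrix.mul_add, ← Matrix.mul_assoc, hA, hU, Matrix.one_mul, Matrix.zero_mul,
        zero_add]
    have e2 : Z * V = A + U * C := by
      rw [hZ]
      simp only [Matrix.add_mul, Matrix.mul_assoc, hB', hV, Matrix.mul_one, Matrix.mul_zero,
        add_zero]
    have e3 : Uᵀ * Z * V = C := by
      rw [e1, Matrix.add_mul, hB', Matrix.mul_assoc, hV, Matrix.mul_one, zero_add]
    refine ⟨?_, by rw [e3, hC]⟩
    have : U * Uᵀ * Z + Z * (V * Vᵀ) - U * Uᵀ * Z * (V * Vᵀ)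
        = U * (Uᵀ * Z) + (Z * V) * Vᵀ - U * (Uᵀ * Z * V) * Vᵀ := by
      simp only [Matrix.mul_assoc]
    rw [this, e3, e1, e2, hZ]
    simp only [Matrix.mul_add, Matrix.add_mul, Matrix.mul_assoc]
    abel
end

section
/- Let U_ξ be a real n×r matrix with Uᵀ U_ξ = 0, V_ξ a real m×r matrix with Vᵀ V_ξ = 0, and S_ξ a real r×r matrix, and set Z = U_ξ Vᵀ + U V_ξᵀ + U S_ξ Vᵀ. Then the gauged parametrization is an isometry: ‖Z‖_F² = ‖U_ξ‖_F² + ‖V_ξ‖_F² + ‖S_ξ‖_F², and moreover ⟨X, Z⟩ = ⟨S, S_ξ⟩. -/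
open Matrix

/-- The gauged parametrization `Z = U_ξ Vᵀ + U V_ξᵀ + U S_ξ Vᵀ` is an isometry:
`‖Z‖_F² = ‖U_ξ‖_F² + ‖V_ξ‖_F² + ‖S_ξ‖_F²`, and `⟨X, Z⟩ = ⟨S, S_ξ⟩` for `X = U S Vᵀ`
(Frobenius inner products given by traces). -/
theorem gauged_parametrization_isometry
    (n m r : ℕ) (hn : 0 < n) (hm : 0 < m) (hr : 0 < r)
    (U : Matrix (Fin n) (Fin r) ℝ) (V : Matrix (Fin m) (Fin r) ℝ)
    (S : Matrix (Fin r) (Fin r) ℝ)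
    (hU : Uᵀ * U = 1) (hV : Vᵀ * V = 1)
    (X : Matrix (Fin n) (Fin m) ℝ) (hX : X = U * S * Vᵀ)
    (Uξ : Matrix (Fin n) (Fin r) ℝ) (Vξ : Matrix (Fin m) (Fin r) ℝ)
    (Sξ : Matrix (Fin r) (Fin r) ℝ)
    (hUξ : Uᵀ * Uξ = 0) (hVξ : Vᵀ * Vξ = 0)
    (Z : Matrix (Fin n) (Fin m) ℝ) (hZ : Z = Uξ * Vᵀ + U * Vξᵀ + U * Sξ * Vᵀ) :
    (Zᵀ * Z).trace = (Uξᵀ * Uξ).trace + (Vξᵀ * Vξ).trace + (Sξᵀ * Sξ).trace ∧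
    (Xᵀ * Z).trace = (Sᵀ * Sξ).trace := by
  have hUξt : Uξᵀ * U = 0 := by
    have := congrArg transpose hUξ
    simpa using this
  have hVξt : Vξᵀ * V = 0 := by
    have := congrArg transpose hVξ
    simpa using this
  have h1 : Uᵀ * Z = Vξᵀ + Sξ * Vᵀ := by
    rw [hZ]
    simp only [Matrix.mul_add, ← Matrix.mul_assoc, hU, hUξ, Matrix.zero_mul, Matrix.one_mul,
      zero_add]
  have h2 : Z * V = Uξ + U * Sξ := by
    rw [hZ]
    simp only [Matrix.add_mul, Matrix.mul_assoc, hV, hVξt, Matrix.mul_zero, Matrix.mul_one,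
      add_zero]
  have h3 : Uᵀ * Z * V = Sξ := by
    rw [h1, Matrix.add_mul, Matrix.mul_assoc, hV, hVξt, Matrix.mul_one, zero_add]
  have e1 : (Zᵀ * (Uξ * Vᵀ)).trace = (Uξᵀ * Uξ).trace := by
    rw [← Matrix.mul_assoc, Matrix.trace_mul_comm, ← Matrix.mul_assoc, ← Matrix.transpose_mul, h2,
      Matrix.transpose_add, Matrix.add_mul, Matrix.transpose_mul, Matrix.mul_assoc, hUξ,
      Matrix.mul_zero, add_zero]
  have e2 : (Zᵀ * (U * Vξᵀ)).trace = (Vξᵀ * Vξ).trace := by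
    have h : Zᵀ * U = Vξ + V * Sξᵀ := by
      have := congrArg transpose h1
      simpa using this
    rw [← Matrix.mul_assoc, Matrix.trace_mul_comm, h, Matrix.mul_add, ← Matrix.mul_assoc, hVξt,
      Matrix.zero_mul, add_zero]
  have e3 : (Zᵀ * (U * Sξ * Vᵀ)).trace = (Sξᵀ * Sξ).trace := by
    have h : Vᵀ * (Zᵀ * U) = Sξᵀ := by
      have := congrArg transpose h3
      simpa using this
    rw [← Matrix.mul_assoc, Matrix.trace_mul_comm, ← Matrix.mul_assoc Zᵀ, ← Matrix.mul_assoc Vᵀ, h]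
  constructor
  · have : Zᵀ * Z = Zᵀ * (Uξ * Vᵀ) + Zᵀ * (U * Vξᵀ) + Zᵀ * (U * Sξ * Vᵀ) := by
      rw [← Matrix.mul_add, ← Matrix.mul_add, ← hZ]
    rw [this, Matrix.trace_add, Matrix.trace_add, e1, e2, e3]
  · have : Xᵀ * Z = V * (Sᵀ * (Uᵀ * Z)) := by
      rw [hX]
      simp only [Matrix.transpose_mul, Matrix.transpose_transpose, Matrix.mul_assoc]
    rw [this, Matrix.trace_mul_comm, Matrix.mul_assoc, h3]
end

section
/- Let A be a real symmetric N×N matrix with eigenvalues λ₁ ≤ λ₂ ≤ ... ≤ λ_N (counted with multiplicity), let x ∈ ℝᴺ with ‖x‖ = 1, and set ρ = xᵀ A x. Then for every z ∈ ℝᴺ with xᵀ z = 0, one has zᵀ (A − ρ I) z ≥ (λ₁ + λ₂ − 2ρ) ‖z‖². -/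
open Matrix

theorem rsl_coord {N : ℕ} (e a b : Fin N → ℝ) (i0 : Fin N) (m1 : ℝ)
    (h0 : e i0 ≤ m1) (h1 : ∀ i, i ≠ i0 → m1 ≤ e i)
    (ha : ∑ i, a i * a i = 1) (hab : ∑ i, a i * b i = 0) :
    (e i0 + m1) * ∑ i, b i * b i ≤
      ∑ i, e i * (b i * b i) + (∑ i, e i * (a i * a i)) * ∑ i, b i * b i := by
  have key : ∀ c : Fin N → ℝ, e i0 * (c i0 * c i0) + m1 * (∑ i, c i * c i - c i0 * c i0) ≤
      ∑ i, e i * (c i * c i) := by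
    intro c
    rw [← Finset.add_sum_erase _ _ (Finset.mem_univ i0),
      ← Finset.add_sum_erase (a := i0) _ (fun i => e i * (c i * c i)) (Finset.mem_univ i0)]
    have : m1 * ∑ i ∈ Finset.univ.erase i0, c i * c i ≤
        ∑ i ∈ Finset.univ.erase i0, e i * (c i * c i) := by
      rw [Finset.mul_sum]
      apply Finset.sum_le_sum
      intro i hi
      exact mul_le_mul_of_nonneg_right (h1 i (Finset.ne_of_mem_erase hi)) (mul_self_nonneg _)
    linarith
  have cs := Finset.sum_mul_sq_le_sq_mul_sq (Finset.univ.erase i0) a b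
  have ea := Finset.add_sum_erase _ (fun i => a i * a i) (Finset.mem_univ i0)
  have eb := Finset.add_sum_erase _ (fun i => b i * b i) (Finset.mem_univ i0)
  have eab := Finset.add_sum_erase _ (fun i => a i * b i) (Finset.mem_univ i0)
  have ka := key a
  have kb := key b
  simp only [pow_two] at cs
  have hB : 0 ≤ ∑ i, b i * b i := Finset.sum_nonneg fun i _ => mul_self_nonneg _
  rw [ha] at ka ea
  rw [hab] at eab
  generalize ∑ i, b i * b i = B at *
  rw [show ∑ i ∈ Finset.univ.erase i0, a i * b i = -(a i0 * b i0) by linarith,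
    show ∑ i ∈ Finset.univ.erase i0, a i * a i = 1 - a i0 * a i0 by linarith,
    show ∑ i ∈ Finset.univ.erase i0, b i * b i = B - b i0 * b i0 by linarith] at cs
  have h2 : 0 ≤ B - b i0 * b i0 - B * (a i0 * a i0) := by nlinarith
  have h3 := mul_nonneg (sub_nonneg.2 h0) h2
  have h4 := mul_le_mul_of_nonneg_right ka hB
  nlinarith

/-- (Notay-type bound.) Let `A` be real symmetric with eigenvalues `μ 0 ≤ μ 1 ≤ …`
(a monotone enumeration, with multiplicity, of the eigenvalues of `A`), let `x` be a unit
vector and `ρ = xᵀ A x`. Then for every `z ⊥ x`,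
`zᵀ (A − ρ I) z ≥ (λ₁ + λ₂ − 2ρ) ‖z‖²`, where `λ₁ = μ 0`, `λ₂ = μ 1`. -/
theorem rayleigh_shift_lower_bound
    (N : ℕ) (hN : 2 ≤ N)
    (A : Matrix (Fin N) (Fin N) ℝ) (hA : A.IsHermitian)
    (μ : Fin N → ℝ) (hmono : Monotone μ)
    (hperm : ∃ σ : Equiv.Perm (Fin N), ∀ i, μ i = hA.eigenvalues (σ i))
    (x : Fin N → ℝ) (hx : x ⬝ᵥ x = 1)
    (ρ : ℝ) (hρ : ρ = x ⬝ᵥ A.mulVec x)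
    (z : Fin N → ℝ) (hz : x ⬝ᵥ z = 0) :
    z ⬝ᵥ ((A - ρ • (1 : Matrix (Fin N) (Fin N) ℝ)).mulVec z) ≥
      (μ ⟨0, by omega⟩ + μ ⟨1, by omega⟩ - 2 * ρ) * (z ⬝ᵥ z) := by
  obtain ⟨σ, hσ⟩ := hperm
  set U : Matrix (Fin N) (Fin N) ℝ := (hA.eigenvectorUnitary : Matrix (Fin N) (Fin N) ℝ) with hU
  have hUU : U * Uᵀ = 1 := by
    have := Unitary.coe_mul_star_self hA.eigenvectorUnitary
    simpa [star_eq_conjTranspose, conjTranspose_eq_transpose_of_trivial] using this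
  have hS : A = U * diagonal hA.eigenvalues * Uᵀ := by
    have := hA.spectral_theorem
    rw [Unitary.conjStarAlgAut_apply] at this
    simpa [star_eq_conjTranspose, conjTranspose_eq_transpose_of_trivial] using this
  have hd : ∀ v w : Fin N → ℝ, v ⬝ᵥ w = ∑ i, (Uᵀ *ᵥ v) i * (Uᵀ *ᵥ w) i := by
    intro v w
    change _ = (Uᵀ *ᵥ v) ⬝ᵥ (Uᵀ *ᵥ w)
    rw [mulVec_transpose U v, ← dotProduct_mulVec, mulVec_mulVec, hUU, one_mulVec]
  have hq : ∀ v : Fin N → ℝ, v ⬝ᵥ A *ᵥ v =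
      ∑ i, hA.eigenvalues i * ((Uᵀ *ᵥ v) i * (Uᵀ *ᵥ v) i) := by
    intro v
    conv_lhs => rw [hS]
    rw [← mulVec_mulVec, ← mulVec_mulVec, dotProduct_mulVec, ← mulVec_transpose]
    simp only [dotProduct, mulVec_diagonal]
    exact Finset.sum_congr rfl fun i _ => by ring
  have main := rsl_coord hA.eigenvalues (Uᵀ *ᵥ x) (Uᵀ *ᵥ z) (σ ⟨0, by omega⟩) (μ ⟨1, by omega⟩)
    (by rw [← hσ]; exact hmono (by simp [Fin.le_def]))
    (by
      intro i hi
      obtain ⟨j, rfl⟩ := σ.surjective i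
      rw [← hσ]
      apply hmono
      rw [Fin.le_def]
      have : j ≠ ⟨0, by omega⟩ := fun h => hi (by rw [h])
      have h' : j.val ≠ 0 := fun h => this (Fin.ext h)
      simp only
      omega)
    (by rw [← hd, hx]) (by rw [← hd, hz])
  rw [← hd, ← hq, ← hq, ← hρ, ← hσ] at main
  rw [sub_mulVec, smul_mulVec, one_mulVec, dotProduct_sub, dotProduct_smul, smul_eq_mul]
  linarith
end

section
/- Let A be a self-adjoint linear operator on the space of real n×m matrices equipped with the Frobenius inner product, with eigenvalues λ₁ ≤ λ₂ ≤ ... (nondecreasing with multiplicity). Assume ‖S‖_F = 1 and set ρ = ⟨X, A(X)⟩. Let U_ξ (n×r, Uᵀ U_ξ = 0), V_ξ (m×r, Vᵀ V_ξ = 0), and S_ξ (r×r, ⟨S_ξ, S⟩ = 0) be not all zero, and set Z = U_ξ Vᵀ + U V_ξᵀ + U S_ξ Vᵀ. Then ⟨Z, A(Z)⟩ − ρ ‖Z‖_F² ≥ (λ₁ + λ₂ − 2ρ) (‖U_ξ‖_F² + ‖V_ξ‖_F² + ‖S_ξ‖_F²). In particular, if ρ < (λ₁ + λ₂)/2 then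 the local quadratic form of the Jacobi correction equation is positive definite on the gauged tangent parameters. -/
open Matrix

/-- Expansion of a matrix in a Frobenius-orthonormal family of full cardinality. -/
lemma frob_expansion {n m : ℕ} (e : Fin (n * m) → Matrix (Fin n) (Fin m) ℝ)
    (horth : ∀ i j, ((e i)ᵀ * e j).trace = if i = j then (1 : ℝ) else 0)
    (Y : Matrix (Fin n) (Fin m) ℝ) :
    Y = ∑ i, ((e i)ᵀ * Y).trace • e i := by
  have key : ∀ (c : Fin (n * m) → ℝ) (i : Fin (n * m)),
      ((e i)ᵀ * ∑ j, c j • e j).trace = c i := by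
    intro c i
    simp [Matrix.mul_sum, Matrix.trace_sum, horth]
  have hli : LinearIndependent ℝ e := by
    rw [Fintype.linearIndependent_iff]
    intro c hc i
    rw [← key c i, hc]
    simp
  have hspan : Submodule.span ℝ (Set.range e) = ⊤ := by
    apply hli.span_eq_top_of_card_eq_finrank'
    simp [Module.finrank_matrix]
  have hY : Y ∈ Submodule.span ℝ (Set.range e) := by
    rw [hspan]; trivial
  obtain ⟨c, hc⟩ := (Submodule.mem_span_range_iff_exists_fun ℝ).1 hY
  have h2 : ∀ i, ((e i)ᵀ * Y).trace = c i := by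
    intro i
    rw [← hc, key]
  simp only [h2]
  exact hc.symm

/-- Parseval. -/
lemma frob_parseval {n m : ℕ} (e : Fin (n * m) → Matrix (Fin n) (Fin m) ℝ)
    (horth : ∀ i j, ((e i)ᵀ * e j).trace = if i = j then (1 : ℝ) else 0)
    (Y W : Matrix (Fin n) (Fin m) ℝ) :
    (Yᵀ * W).trace = ∑ i, ((e i)ᵀ * Y).trace * ((e i)ᵀ * W).trace := by
  conv_lhs => rw [frob_expansion e horth Y]
  simp [Matrix.transpose_sum, Matrix.sum_mul, Matrix.trace_sum]

/-- Cyclic shuffle for sandwiched products. -/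
lemma frob_sandwich {n m r : ℕ} (P Q : Matrix (Fin n) (Fin r) ℝ)
    (R T : Matrix (Fin m) (Fin r) ℝ) :
    ((P * Rᵀ)ᵀ * (Q * Tᵀ)).trace = ((Pᵀ * Q) * (Tᵀ * R)).trace := by
  rw [Matrix.transpose_mul, Matrix.transpose_transpose, Matrix.mul_assoc, Matrix.trace_mul_comm]
  simp only [Matrix.mul_assoc]

/-- Positive definiteness bound for the local quadratic form of the Jacobi correction
equation: for a self-adjoint operator `A` on `n×m` matrices with Frobenius inner product
whose eigenvalues (listed nondecreasingly via an orthonormal eigenbasis `e` with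
eigenvalues `μ`) start with `λ₁ = μ 0`, `λ₂ = μ 1`, a unit `X = U S Vᵀ`, `ρ = ⟨X, A X⟩`,
and gauged tangent parameters `(U_ξ, V_ξ, S_ξ)` not all zero with
`Z = U_ξ Vᵀ + U V_ξᵀ + U S_ξ Vᵀ`, one has
`⟨Z, A Z⟩ − ρ ‖Z‖² ≥ (λ₁ + λ₂ − 2ρ)(‖U_ξ‖² + ‖V_ξ‖² + ‖S_ξ‖²)`. -/
theorem local_quadratic_form_lower_bound
    (n m r : ℕ) (hn : 0 < n) (hm : 0 < m) (hr : 0 < r) (hnm : 2 ≤ n * m)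
    (U : Matrix (Fin n) (Fin r) ℝ) (V : Matrix (Fin m) (Fin r) ℝ)
    (S : Matrix (Fin r) (Fin r) ℝ)
    (hU : Uᵀ * U = 1) (hV : Vᵀ * V = 1)
    (hS : (Sᵀ * S).trace = 1)
    (X : Matrix (Fin n) (Fin m) ℝ) (hX : X = U * S * Vᵀ)
    (A : Matrix (Fin n) (Fin m) ℝ →ₗ[ℝ] Matrix (Fin n) (Fin m) ℝ)
    (hAsa : ∀ Y Z : Matrix (Fin n) (Fin m) ℝ, ((A Y)ᵀ * Z).trace = (Yᵀ * A Z).trace)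
    (μ : Fin (n * m) → ℝ) (hmono : Monotone μ)
    (e : Fin (n * m) → Matrix (Fin n) (Fin m) ℝ)
    (heig : ∀ i, A (e i) = μ i • e i)
    (horth : ∀ i j, ((e i)ᵀ * e j).trace = if i = j then (1 : ℝ) else 0)
    (ρ : ℝ) (hρ : ρ = (Xᵀ * A X).trace)
    (Uξ : Matrix (Fin n) (Fin r) ℝ) (Vξ : Matrix (Fin m) (Fin r) ℝ)
    (Sξ : Matrix (Fin r) (Fin r) ℝ)
    (hUξ : Uᵀ * Uξ = 0) (hVξ : Vᵀ * Vξ = 0) (hSξ : (Sξᵀ * S).trace = 0)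
    (hne : ¬(Uξ = 0 ∧ Vξ = 0 ∧ Sξ = 0))
    (Z : Matrix (Fin n) (Fin m) ℝ) (hZ : Z = Uξ * Vᵀ + U * Vξᵀ + U * Sξ * Vᵀ) :
    (Zᵀ * A Z).trace - ρ * (Zᵀ * Z).trace ≥
      (μ ⟨0, by omega⟩ + μ ⟨1, by omega⟩ - 2 * ρ) *
        ((Uξᵀ * Uξ).trace + (Vξᵀ * Vξ).trace + (Sξᵀ * Sξ).trace) := by
  have hVξ' : Vξᵀ * V = 0 := by
    have := congrArg Matrix.transpose hVξ
    simpa using this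
  have hUξ' : Uξᵀ * U = 0 := by
    have := congrArg Matrix.transpose hUξ
    simpa using this
  have a1 : ∀ T : Matrix (Fin r) (Fin r) ℝ, Uᵀ * (U * T) = T := by
    intro T; rw [← Matrix.mul_assoc, hU, Matrix.one_mul]
  have a2 : ∀ T : Matrix (Fin r) (Fin r) ℝ, Uξᵀ * (U * T) = 0 := by
    intro T; rw [← Matrix.mul_assoc, hUξ', Matrix.zero_mul]
  set N : ℝ := (Uξᵀ * Uξ).trace + (Vξᵀ * Vξ).trace + (Sξᵀ * Sξ).trace with hN
  have hXX : (Xᵀ * X).trace = 1 := by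
    rw [hX, frob_sandwich, hV]
    simp [Matrix.mul_assoc, a1, hS]
  have hZX : (Zᵀ * X).trace = 0 := by
    rw [hZ, hX]
    simp only [Matrix.transpose_add, Matrix.add_mul, Matrix.trace_add, frob_sandwich, hV, hVξ]
    simp [Matrix.mul_assoc, a1, a2, hSξ, hVξ]
  have hZZ : (Zᵀ * Z).trace = N := by
    rw [hZ]
    simp only [Matrix.transpose_add, Matrix.add_mul, Matrix.mul_add, Matrix.trace_add,
      frob_sandwich, hV, hVξ, hVξ', hN]
    simp [Matrix.mul_assoc, a1, a2, hU, hUξ, hUξ', hVξ, hVξ']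
  have hN0 : 0 ≤ N := by
    rw [← hZZ, frob_parseval e horth]
    exact Finset.sum_nonneg fun i _ => mul_self_nonneg _
  set x : Fin (n * m) → ℝ := fun i => ((e i)ᵀ * X).trace with hx
  set z : Fin (n * m) → ℝ := fun i => ((e i)ᵀ * Z).trace with hz
  have hAc : ∀ (Y : Matrix (Fin n) (Fin m) ℝ) i,
      ((e i)ᵀ * A Y).trace = μ i * ((e i)ᵀ * Y).trace := by
    intro Y i
    rw [← hAsa, heig]
    simp
  have sx : ∑ i, x i * x i = 1 := by rw [← hXX, frob_parseval e horth]
  have sz : ∑ i, z i * z i = N := by rw [← hZZ, frob_parseval e horth]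
  have szx : ∑ i, z i * x i = 0 := by rw [← hZX, frob_parseval e horth]
  have hρ' : ρ = ∑ i, x i * (μ i * x i) := by
    rw [hρ, frob_parseval e horth]; simp only [hAc, hx]
  have hZA : (Zᵀ * A Z).trace = ∑ i, z i * (μ i * z i) := by
    rw [frob_parseval e horth]; simp only [hAc, hz]
  set i0 : Fin (n * m) := ⟨0, by omega⟩ with hi0
  set i1 : Fin (n * m) := ⟨1, by omega⟩ with hi1
  have hsum : ∑ i, (N * (x i * x i) + z i * z i) = 2 * N := by
    rw [Finset.sum_add_distrib, ← Finset.mul_sum, sx, sz]; ring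
  have hwnn : ∀ i, 0 ≤ N * (x i * x i) + z i * z i := fun i =>
    add_nonneg (mul_nonneg hN0 (mul_self_nonneg _)) (mul_self_nonneg _)
  have hw0 : N * (x i0 * x i0) + z i0 * z i0 ≤ N := by
    rcases hN0.eq_or_lt with h0 | hpos
    · have := Finset.single_le_sum (fun i _ => hwnn i) (Finset.mem_univ i0)
      rw [hsum] at this
      linarith
    · have hq : 0 ≤ ∑ i, (N * (if i = i0 then 1 else 0) - N * x i0 * x i - z i0 * z i) ^ 2 :=
        Finset.sum_nonneg fun i _ => sq_nonneg _
      have hexp : ∑ i, (N * (if i = i0 then 1 else 0) - N * x i0 * x i - z i0 * z i) ^ 2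
          = N * (N - (N * (x i0 * x i0) + z i0 * z i0)) := by
        have : ∀ i, (N * (if i = i0 then 1 else 0) - N * x i0 * x i - z i0 * z i) ^ 2
          = (if i = i0 then N ^ 2 - 2 * N * (N * x i0 * x i + z i0 * z i) else 0)
            + (N * x i0) ^ 2 * (x i * x i) + z i0 ^ 2 * (z i * z i)
            + 2 * N * x i0 * z i0 * (z i * x i) := by
          intro i
          split_ifs <;> ring
        simp only [this, Finset.sum_add_distrib, ← Finset.mul_sum, sx, sz, szx]
        simp
        ring
      rw [hexp] at hq
      have := nonneg_of_mul_nonneg_right hq hpos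
      linarith
  have h01 : μ i0 ≤ μ i1 := hmono (by simp [hi0, hi1])
  have hmain : ∑ i, (μ i1 * (N * (x i * x i) + z i * z i)
      - (if i = i0 then (μ i1 - μ i0) * (N * (x i * x i) + z i * z i) else 0))
      ≤ ∑ i, μ i * (N * (x i * x i) + z i * z i) := by
    apply Finset.sum_le_sum
    intro i _
    split_ifs with h
    · subst h; apply le_of_eq; ring
    · have : μ i1 ≤ μ i := by
        apply hmono
        rw [Fin.le_def]
        have : i.val ≠ 0 := fun h' => h (Fin.ext h')
        simp only [hi1]; omega
      rw [sub_zero]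
      exact mul_le_mul_of_nonneg_right this (hwnn i)
  rw [Finset.sum_sub_distrib, ← Finset.mul_sum, hsum] at hmain
  simp only [Finset.sum_ite_eq', Finset.mem_univ, if_true] at hmain
  have hR : ∑ i, μ i * (N * (x i * x i) + z i * z i) = N * ρ + (Zᵀ * A Z).trace := by
    rw [hρ', hZA, Finset.mul_sum, ← Finset.sum_add_distrib]
    apply Finset.sum_congr rfl
    intro i _; ring
  rw [hR] at hmain
  rw [hZZ]
  have := mul_nonneg (sub_nonneg.2 h01) (sub_nonneg.2 hw0)
  nlinarith
end

section
/- Let A be a real N×N matrix, P a real symmetric idempotent N×N matrix (Pᵀ = P, P² = P), and x ∈ ℝᴺ with ‖x‖ = 1 and P x = x; set ρ = xᵀ A x. Suppose ξ ∈ ℝᴺ satisfies P ξ = ξ, xᵀ ξ = 0, and the projected Jacobi correction equation (I − x xᵀ) P (A − ρ I) P ξ = − P (I − x xᵀ) A x. Then P (A − ρ I) P (x + ξ) = α x, where α = xᵀ P (A − ρ I) P ξ. (Hence one step of the exactly-solved low-rank Jacobi–Davidson correction is, up to normalization, one step of the projected Rayleigh quotient iteration.) -/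
open Matrix

/-- One step of the exactly-solved low-rank Jacobi–Davidson correction is, up to
normalization, one step of the projected Rayleigh quotient iteration: if `P` is a
symmetric idempotent with `P x = x`, `‖x‖ = 1`, `ρ = xᵀ A x`, and `ξ` solves the projected
Jacobi correction equation `(I − x xᵀ) P (A − ρ I) P ξ = −P (I − x xᵀ) A x` with `P ξ = ξ`
and `xᵀ ξ = 0`, then `P (A − ρ I) P (x + ξ) = α x` with `α = xᵀ P (A − ρ I) P ξ`. -/
theorem jacobi_correction_gives_rq_iteration
    (N : ℕ) (hN : 0 < N)
    (A P : Matrix (Fin N) (Fin N) ℝ)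
    (hPsymm : Pᵀ = P) (hPidem : P * P = P)
    (x : Fin N → ℝ) (hx : x ⬝ᵥ x = 1) (hPx : P.mulVec x = x)
    (ρ : ℝ) (hρ : ρ = x ⬝ᵥ A.mulVec x)
    (ξ : Fin N → ℝ) (hPξ : P.mulVec ξ = ξ) (hxξ : x ⬝ᵥ ξ = 0)
    (hJac : ((1 - vecMulVec x x) * P * (A - ρ • (1 : Matrix (Fin N) (Fin N) ℝ)) * P).mulVec ξ
      = -((P * (1 - vecMulVec x x) * A).mulVec x))
    (α : ℝ)
    (hα : α = x ⬝ᵥ ((P * (A - ρ • (1 : Matrix (Fin N) (Fin N) ℝ)) * P).mulVec ξ)) :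
    (P * (A - ρ • (1 : Matrix (Fin N) (Fin N) ℝ)) * P).mulVec (x + ξ) = α • x := by
  have key : ∀ v : Fin N → ℝ, (1 - vecMulVec x x).mulVec v = v - (x ⬝ᵥ v) • x := by
    intro v
    rw [Matrix.sub_mulVec, Matrix.one_mulVec, Matrix.vecMulVec_mulVec]
    simp
  have h1 : ((1 - vecMulVec x x) * P * (A - ρ • (1 : Matrix (Fin N) (Fin N) ℝ)) * P).mulVec ξ
      = (P * (A - ρ • (1 : Matrix (Fin N) (Fin N) ℝ)) * P).mulVec ξ - α • x := by
    rw [hα, ← key, Matrix.mulVec_mulVec]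
    simp only [Matrix.mul_assoc]
  have h2 : (P * (1 - vecMulVec x x) * A).mulVec x = P.mulVec (A.mulVec x) - ρ • x := by
    rw [← Matrix.mulVec_mulVec, ← Matrix.mulVec_mulVec, key, ← hρ, Matrix.mulVec_sub,
      Matrix.mulVec_smul, hPx]
  have h3 : (P * (A - ρ • (1 : Matrix (Fin N) (Fin N) ℝ)) * P).mulVec x
      = P.mulVec (A.mulVec x) - ρ • x := by
    rw [← Matrix.mulVec_mulVec, ← Matrix.mulVec_mulVec, hPx, Matrix.sub_mulVec,
      Matrix.smul_mulVec, Matrix.one_mulVec, Matrix.mulVec_sub, Matrix.mulVec_smul, hPx]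
  rw [h1, h2] at hJac
  rw [Matrix.mulVec_add, h3, sub_eq_iff_eq_add.mp hJac]
  abel
end

section
/- Let M be an invertible real N×N matrix, x ∈ ℝᴺ with ‖x‖ = 1 and xᵀ M⁻¹ x ≠ 0, and z ∈ ℝᴺ with xᵀ z = 0. Define λ = −(xᵀ M⁻¹ z)/(xᵀ M⁻¹ x) and y = λ M⁻¹ x + M⁻¹ z. Then xᵀ y = 0 and (I − x xᵀ) M (I − x xᵀ) y = z, i.e. y is the explicit solution of the projected preconditioner system on the orthogonal complement of x. -/
open Matrix

/-- Explicit solution of the projected preconditioner system on the orthogonal complement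
of `x`: with `λ = −(xᵀ M⁻¹ z)/(xᵀ M⁻¹ x)` and `y = λ M⁻¹ x + M⁻¹ z`, one has `xᵀ y = 0`
and `(I − x xᵀ) M (I − x xᵀ) y = z`. -/
theorem projected_preconditioner_explicit_solution
    (N : ℕ) (hN : 0 < N)
    (M : Matrix (Fin N) (Fin N) ℝ) (hM : IsUnit M)
    (x : Fin N → ℝ) (hx : x ⬝ᵥ x = 1)
    (hxMx : x ⬝ᵥ M⁻¹.mulVec x ≠ 0)
    (z : Fin N → ℝ) (hz : x ⬝ᵥ z = 0)
    (lam : ℝ) (hlam : lam = -(x ⬝ᵥ M⁻¹.mulVec z) / (x ⬝ᵥ M⁻¹.mulVec x))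
    (y : Fin N → ℝ) (hy : y = lam • M⁻¹.mulVec x + M⁻¹.mulVec z) :
    x ⬝ᵥ y = 0 ∧
    ((1 - vecMulVec x x) * M * (1 - vecMulVec x x)).mulVec y = z := by
  have hP : ∀ v : Fin N → ℝ, (1 - vecMulVec x x).mulVec v = v - (x ⬝ᵥ v) • x := by
    intro v
    rw [sub_mulVec, one_mulVec, vecMulVec_mulVec]
    simp
  have h1 : x ⬝ᵥ y = 0 := by
    rw [hy, dotProduct_add, dotProduct_smul, hlam, smul_eq_mul, div_mul_cancel₀ _ hxMx]
    ring
  have hdet : IsUnit M.det := (isUnit_iff_isUnit_det M).1 hM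
  have hMy : M.mulVec y = lam • x + z := by
    rw [hy, mulVec_add, mulVec_smul, mulVec_mulVec, mulVec_mulVec, mul_nonsing_inv M hdet,
      one_mulVec, one_mulVec]
  refine ⟨h1, ?_⟩
  rw [← mulVec_mulVec, ← mulVec_mulVec, hP y, h1, zero_smul, sub_zero, hMy, hP, dotProduct_add,
    dotProduct_smul, hx, hz]
  simp
end

section
/- Let M be an invertible real N×N matrix and C a real N×k matrix with CᵀC = I_k such that the k×k matrix K = Cᵀ M⁻¹ C is invertible. Let z ∈ ℝᴺ satisfy Cᵀ z = 0. Define Λ = −K⁻¹ Cᵀ M⁻¹ z and y = M⁻¹ C Λ + M⁻¹ z. Then Cᵀ y = 0 and (I − C Cᵀ) M (I − C Cᵀ) y = z, i.e. y is the explicit solution of the block-projected preconditioner system on the orthogonal complement of the range of C. -/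
open Matrix

/-- Explicit solution of the block-projected preconditioner system on the orthogonal
complement of the range of `C` (where `CᵀC = I_k`): with `K = Cᵀ M⁻¹ C` invertible,
`Λ = −K⁻¹ Cᵀ M⁻¹ z` and `y = M⁻¹ C Λ + M⁻¹ z`, one has `Cᵀ y = 0` and
`(I − C Cᵀ) M (I − C Cᵀ) y = z`. -/
theorem block_projected_preconditioner_explicit_solution
    (N k : ℕ) (hN : 0 < N) (hk : 0 < k) (hkN : k ≤ N)
    (M : Matrix (Fin N) (Fin N) ℝ) (hM : IsUnit M)
    (C : Matrix (Fin N) (Fin k) ℝ) (hC : Cᵀ * C = 1)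
    (K : Matrix (Fin k) (Fin k) ℝ) (hK : K = Cᵀ * M⁻¹ * C) (hKunit : IsUnit K)
    (z : Fin N → ℝ) (hz : Cᵀ.mulVec z = 0)
    (Λ : Fin k → ℝ) (hΛ : Λ = -(K⁻¹.mulVec ((Cᵀ * M⁻¹).mulVec z)))
    (y : Fin N → ℝ) (hy : y = (M⁻¹ * C).mulVec Λ + M⁻¹.mulVec z) :
    Cᵀ.mulVec y = 0 ∧
    ((1 - C * Cᵀ) * M * (1 - C * Cᵀ)).mulVec y = z := by
  have hMd := (Matrix.isUnit_iff_isUnit_det M).1 hM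
  have hKd := (Matrix.isUnit_iff_isUnit_det K).1 hKunit
  have h1 : Cᵀ.mulVec y = 0 := by
    have hKΛ : K.mulVec Λ = -((Cᵀ * M⁻¹).mulVec z) := by
      rw [hΛ, Matrix.mulVec_neg, Matrix.mulVec_mulVec, Matrix.mul_nonsing_inv _ hKd,
        Matrix.one_mulVec]
    rw [hy, Matrix.mulVec_add, Matrix.mulVec_mulVec, Matrix.mulVec_mulVec, ← Matrix.mul_assoc,
      ← hK, hKΛ, neg_add_cancel]
  refine ⟨h1, ?_⟩
  have h2 : M.mulVec y = C.mulVec Λ + z := by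
    rw [hy, Matrix.mulVec_add, Matrix.mulVec_mulVec, Matrix.mulVec_mulVec, ← Matrix.mul_assoc,
      Matrix.mul_nonsing_inv _ hMd, Matrix.one_mul, Matrix.one_mulVec]
  have h3 : (1 - C * Cᵀ).mulVec y = y := by
    rw [Matrix.sub_mulVec, Matrix.one_mulVec, ← Matrix.mulVec_mulVec, h1, Matrix.mulVec_zero,
      sub_zero]
  rw [← Matrix.mulVec_mulVec, h3, ← Matrix.mulVec_mulVec, h2, Matrix.sub_mulVec,
    Matrix.one_mulVec, ← Matrix.mulVec_mulVec, Matrix.mulVec_add, hz, Matrix.mulVec_mulVec, hC,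
    Matrix.one_mulVec, add_zero, add_sub_cancel_left]
end
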